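/- arXiv:1208.3017 — 2 statements merged into one kernel-verified Lean document; each statement's English description precedes it below -/
import Mathlib

section
/- Let M be a k×n matrix over F_2, let X^n be uniform on F_2^n, let S = X^n M^T, and let Z^n be the output of n independent uses of BEC(ε) with input X^n. Then the leaked information I(M) := I(S; Z^n) (mutual information in nats) satisfies I(M) ≤ n · P_ML(M, 1−ε), where P_ML(M, 1−ε) = Σ_{J ⊆ {1,…,n}} (1−ε)^{|J|} ε^{n−|J|} · 1[rank(M_{J^c}) < k] is the maximum-likelihood decoding error probability of the linear code with generator matrix M over a binary erasure channel with erasure probability 1−ε. -/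
open scoped BigOperators

/-- Joint pmf of the uniform input `x` on `F_2^n` and the output `z` of `n` independent
uses of a binary erasure channel with erasure probability `ε`
(`none` is the erasure symbol `?`). -/
noncomputable def becJoint (n : ℕ) (ε : ℝ) (x : Fin n → ZMod 2)
    (z : Fin n → Option (ZMod 2)) : ℝ :=
  (1 / 2 ^ n) * ∏ i, (if z i = some (x i) then 1 - ε else if z i = none then ε else 0)

/-- Joint pmf of `S = X M^T` and `Z^n`. -/
noncomputable def jointSZbec (k n : ℕ) (M : Matrix (Fin k) (Fin n) (ZMod 2)) (ε : ℝ)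
    (s : Fin k → ZMod 2) (z : Fin n → Option (ZMod 2)) : ℝ :=
  ∑ x ∈ Finset.univ.filter fun x => M.mulVec x = s, becJoint n ε x z

/-- Leaked information `I(M) = I(S; Z^n)` in nats, for `S = X M^T` with `X` uniform on
`F_2^n` and `Z^n` the output of the BEC(ε) with input `X`. -/
noncomputable def leakBEC (k n : ℕ) (M : Matrix (Fin k) (Fin n) (ZMod 2)) (ε : ℝ) : ℝ :=
  ∑ s : Fin k → ZMod 2, ∑ z : Fin n → Option (ZMod 2),
    jointSZbec k n M ε s z *
      Real.log (jointSZbec k n M ε s z /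
        ((∑ z', jointSZbec k n M ε s z') * (∑ s', jointSZbec k n M ε s' z)))

/-- Maximum-likelihood decoding error probability (ties counted as errors) of the linear
code with generator matrix `M` over a binary erasure channel with erasure probability `δ`:
`Σ_J δ^{|J|} (1-δ)^{n-|J|} · 1[rank(M_{J^c}) < k]`. -/
noncomputable def pmlBEC (k n : ℕ) (M : Matrix (Fin k) (Fin n) (ZMod 2)) (δ : ℝ) : ℝ :=
  ∑ J : Finset (Fin n),
    δ ^ J.card * (1 - δ) ^ (n - J.card) *
      (if (M.submatrix id (Subtype.val : {i : Fin n // i ∉ J} → Fin n)).rank < k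
        then (1:ℝ) else 0)

/-- The set of unerased positions of a channel output. -/
def unerased {n : ℕ} (z : Fin n → Option (ZMod 2)) : Finset (Fin n) :=
  Finset.univ.filter fun i => z i ≠ none

lemma becJoint_nonneg {n : ℕ} {ε : ℝ} (hε0 : 0 ≤ ε) (hε1 : ε ≤ 1) (x : Fin n → ZMod 2)
    (z : Fin n → Option (ZMod 2)) : 0 ≤ becJoint n ε x z := by
  refine mul_nonneg (by positivity) (Finset.prod_nonneg fun i _ => ?_)
  split_ifs <;> linarith

lemma jointSZbec_nonneg {k n : ℕ} (M : Matrix (Fin k) (Fin n) (ZMod 2)) {ε : ℝ}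
    (hε0 : 0 ≤ ε) (hε1 : ε ≤ 1) (s : Fin k → ZMod 2) (z : Fin n → Option (ZMod 2)) :
    0 ≤ jointSZbec k n M ε s z :=
  Finset.sum_nonneg fun _ _ => becJoint_nonneg hε0 hε1 _ _

lemma sum_becJoint_mul {n : ℕ} (ε : ℝ) (x : Fin n → ZMod 2) (g : Finset (Fin n) → ℝ) :
    ∑ z, becJoint n ε x z * g (unerased z) =
      (1 / 2 ^ n) * ∑ J : Finset (Fin n), (1 - ε) ^ J.card * ε ^ (n - J.card) * g J := by
  rw [Finset.mul_sum]
  symm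
  have hJ : ∀ J : Finset (Fin n),
      unerased (fun i => if i ∈ J then some (x i) else none) = J := by
    intro J; ext i; simp [unerased]
  refine Finset.sum_of_injOn (fun J i => if i ∈ J then some (x i) else none) ?_ ?_ ?_ ?_
  · intro J _ J' _ h
    rw [← hJ J, ← hJ J']
    exact congrArg unerased h
  · simp
  · intro z _ hz
    suffices becJoint n ε x z = 0 by rw [this, zero_mul]
    by_contra hne
    apply hz
    refine ⟨unerased z, by simp, ?_⟩
    funext i
    have hi : (if z i = some (x i) then 1 - ε else if z i = none then ε else 0) ≠ 0 :=
      Finset.prod_ne_zero_iff.1 (right_ne_zero_of_mul hne) i (Finset.mem_univ i)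
    by_cases h0 : z i = none
    · simp [unerased, h0]
    · by_cases h1 : z i = some (x i)
      · simp [unerased, h1]
      · simp [h0, h1] at hi
  · intro J _
    simp only [hJ]
    have : becJoint n ε x (fun i => if i ∈ J then some (x i) else none) =
        1 / 2 ^ n * ((1 - ε) ^ J.card * ε ^ (n - J.card)) := by
      unfold becJoint
      congr 1
      have h : ∀ i, (if (if i ∈ J then some (x i) else none) = some (x i) then 1 - ε
          else if (if i ∈ J then some (x i) else none) = none then ε else 0) =
          if i ∈ J then 1 - ε else ε := by
        intro i; by_cases hi : i ∈ J <;> simp [hi]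
      simp only [h]
      rw [Finset.prod_ite, Finset.prod_const, Finset.prod_const, Finset.filter_not,
        Finset.filter_mem_eq_inter, Finset.univ_inter,
        Finset.card_sdiff_of_subset (Finset.subset_univ _), Finset.card_univ, Fintype.card_fin]
    rw [this]; ring

lemma sum_becJoint {n : ℕ} (ε : ℝ) (x : Fin n → ZMod 2) :
    ∑ z, becJoint n ε x z = 1 / 2 ^ n := by
  have h := sum_becJoint_mul ε x (fun _ => 1)
  have h2 : ∑ J : Finset (Fin n), (1 - ε) ^ J.card * ε ^ (n - J.card) = 1 := by
    have := Fintype.sum_pow_mul_eq_add_pow (Fin n) (1 - ε) ε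
    simpa using this
  simpa [h2] using h

lemma sum_jointSZbec_left {k n : ℕ} (M : Matrix (Fin k) (Fin n) (ZMod 2)) (ε : ℝ)
    (z : Fin n → Option (ZMod 2)) :
    ∑ s, jointSZbec k n M ε s z = ∑ x, becJoint n ε x z :=
  Finset.sum_fiberwise _ _ _

lemma sum_jointSZbec_right {k n : ℕ} (M : Matrix (Fin k) (Fin n) (ZMod 2)) (ε : ℝ)
    (s : Fin k → ZMod 2) :
    ∑ z, jointSZbec k n M ε s z = ∑ x with M.mulVec x = s, (1 / 2 ^ n : ℝ) := by
  unfold jointSZbec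
  rw [Finset.sum_comm]
  exact Finset.sum_congr rfl fun x _ => sum_becJoint ε x

lemma sum_jointSZbec {k n : ℕ} (M : Matrix (Fin k) (Fin n) (ZMod 2)) (ε : ℝ) :
    ∑ s, ∑ z, jointSZbec k n M ε s z = 1 := by
  rw [Finset.sum_comm]
  simp only [sum_jointSZbec_left]
  rw [Finset.sum_comm]
  simp [sum_becJoint]

lemma sum_mulVec_fiber_eq {k n : ℕ} (M : Matrix (Fin k) (Fin n) (ZMod 2))
    (f : (Fin n → ZMod 2) → ℝ) (v : Fin n → ZMod 2) (hf : ∀ x, f (x + v) = f x)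
    {s s' : Fin k → ZMod 2} (hv : M.mulVec v = s' - s) :
    ∑ x with M.mulVec x = s, f x = ∑ x with M.mulVec x = s', f x := by
  refine Finset.sum_equiv (Equiv.addRight v) (fun x => ?_) (fun x _ => (hf x).symm)
  simp [Matrix.mulVec_add, hv, ← eq_sub_iff_add_eq]

lemma exists_mulVec_eq_of_rank_submatrix {k n : ℕ} (M : Matrix (Fin k) (Fin n) (ZMod 2))
    (J : Finset (Fin n))
    (h : ¬ (M.submatrix id (Subtype.val : {i : Fin n // i ∉ J} → Fin n)).rank < k)
    (t : Fin k → ZMod 2) : ∃ v, M.mulVec v = t ∧ ∀ i ∈ J, v i = 0 := by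
  set N := M.submatrix id (Subtype.val : {i : Fin n // i ∉ J} → Fin n)
  have htop : LinearMap.range N.mulVecLin = ⊤ := by
    apply Submodule.eq_top_of_finrank_eq
    rw [Module.finrank_fin_fun]
    change N.rank = k
    exact le_antisymm (N.rank_le_card_height.trans_eq (Fintype.card_fin k)) (not_lt.1 h)
  obtain ⟨y, hy⟩ := LinearMap.range_eq_top.1 htop t
  refine ⟨fun i => if hi : i ∉ J then y ⟨i, hi⟩ else 0, ?_, fun i hi => by simp [hi]⟩
  rw [← hy]
  funext a
  simp only [Matrix.mulVecLin_apply, Matrix.mulVec, dotProduct]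
  symm
  refine Finset.sum_of_injOn Subtype.val Subtype.val_injective.injOn (by simp) ?_ ?_
  · intro i _ hi
    have : i ∈ J := by simpa using hi
    simp [this]
  · rintro ⟨i, hi⟩ _
    simp [N, hi]

lemma becJoint_add_of_eq_zero {n : ℕ} (ε : ℝ) (x v : Fin n → ZMod 2)
    (z : Fin n → Option (ZMod 2)) (hv : ∀ i ∈ unerased z, v i = 0) :
    becJoint n ε (x + v) z = becJoint n ε x z := by
  unfold becJoint
  congr 1
  refine Finset.prod_congr rfl fun i _ => ?_
  by_cases h : z i = none
  · simp [h]
  · simp [hv i (by simpa [unerased] using h)]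

/-- If the erased columns of `M` have full row rank, then `S` is independent of the event
`Z = z`. -/
lemma jointSZbec_eq_mul {k n : ℕ} (M : Matrix (Fin k) (Fin n) (ZMod 2)) (ε : ℝ)
    (s : Fin k → ZMod 2) (z : Fin n → Option (ZMod 2))
    (h : ¬ (M.submatrix id
      (Subtype.val : {i : Fin n // i ∉ unerased z} → Fin n)).rank < k) :
    (∑ z', jointSZbec k n M ε s z') * (∑ s', jointSZbec k n M ε s' z) =
      jointSZbec k n M ε s z := by
  have h1 : ∀ s', jointSZbec k n M ε s' z = jointSZbec k n M ε s z := fun s' => by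
    obtain ⟨v, hv, hv0⟩ := exists_mulVec_eq_of_rank_submatrix M _ h (s - s')
    exact sum_mulVec_fiber_eq M _ v (fun x => becJoint_add_of_eq_zero ε x v z hv0) hv
  have h2 : ∀ s', ∑ z', jointSZbec k n M ε s' z' = ∑ z', jointSZbec k n M ε s z' := fun s' => by
    obtain ⟨v, hv, -⟩ := exists_mulVec_eq_of_rank_submatrix M _ h (s - s')
    rw [sum_jointSZbec_right, sum_jointSZbec_right]
    exact sum_mulVec_fiber_eq M _ v (fun _ => rfl) hv
  have h3 := sum_jointSZbec M ε
  rw [Finset.sum_congr rfl fun s' _ => h2 s', Finset.sum_const, nsmul_eq_mul] at h3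
  rw [Finset.sum_congr rfl fun s' _ => h1 s', Finset.sum_const, nsmul_eq_mul]
  linear_combination jointSZbec k n M ε s z * h3

lemma log_ratio_le {k n : ℕ} (M : Matrix (Fin k) (Fin n) (ZMod 2)) {ε : ℝ}
    (hε0 : 0 ≤ ε) (hε1 : ε ≤ 1) (s : Fin k → ZMod 2) (z : Fin n → Option (ZMod 2))
    (hpos : 0 < jointSZbec k n M ε s z) :
    Real.log (jointSZbec k n M ε s z /
        ((∑ z', jointSZbec k n M ε s z') * (∑ s', jointSZbec k n M ε s' z))) ≤ n := by
  have hz : jointSZbec k n M ε s z ≤ ∑ s', jointSZbec k n M ε s' z :=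
    Finset.single_le_sum (f := fun s' => jointSZbec k n M ε s' z)
      (fun _ _ => jointSZbec_nonneg M hε0 hε1 _ _) (Finset.mem_univ s)
  have hs : (1 / 2 ^ n : ℝ) ≤ ∑ z', jointSZbec k n M ε s z' := by
    obtain ⟨x, hx, -⟩ := Finset.exists_ne_zero_of_sum_ne_zero hpos.ne'
    rw [sum_jointSZbec_right]
    exact Finset.single_le_sum (f := fun _ => (1 / 2 ^ n : ℝ)) (fun _ _ => by positivity) hx
  have hs0 : 0 < ∑ z', jointSZbec k n M ε s z' := lt_of_lt_of_le (by positivity) hs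
  have hz0 := hpos.trans_le hz
  have hratio : jointSZbec k n M ε s z /
      ((∑ z', jointSZbec k n M ε s z') * (∑ s', jointSZbec k n M ε s' z)) ≤ 2 ^ n := by
    rw [div_le_iff₀ (mul_pos hs0 hz0)]
    have h1 : 1 ≤ 2 ^ n * ∑ z', jointSZbec k n M ε s z' := by
      rwa [div_le_iff₀' (by positivity)] at hs
    calc _ ≤ 1 * ∑ s', jointSZbec k n M ε s' z := by rwa [one_mul]
      _ ≤ _ := by rw [← mul_assoc]; gcongr
  calc _ ≤ Real.log (2 ^ n) := Real.log_le_log (div_pos hpos (mul_pos hs0 hz0)) hratio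
    _ = n * Real.log 2 := Real.log_pow _ _
    _ ≤ n * 1 := by gcongr; linarith [Real.log_two_lt_d9]
    _ = n := mul_one _

/-- Theorem 1 of the paper: `I(M) ≤ n · P_ML(M, 1-ε)`. -/
theorem leaked_le_n_mul_pml (k n : ℕ) (M : Matrix (Fin k) (Fin n) (ZMod 2)) (ε : ℝ)
    (hε0 : 0 ≤ ε) (hε1 : ε ≤ 1) :
    leakBEC k n M ε ≤ n * pmlBEC k n M (1 - ε) := by
  let g : Finset (Fin n) → ℝ := fun J =>
    if (M.submatrix id (Subtype.val : {i : Fin n // i ∉ J} → Fin n)).rank < k then 1 else 0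
  calc leakBEC k n M ε
      ≤ ∑ s, ∑ z, jointSZbec k n M ε s z * (n * g (unerased z)) := by
        refine Finset.sum_le_sum fun s _ => Finset.sum_le_sum fun z _ => ?_
        rcases (jointSZbec_nonneg M hε0 hε1 s z).eq_or_lt with h0 | hpos
        · simp [← h0]
        · refine mul_le_mul_of_nonneg_left ?_ hpos.le
          by_cases h : (M.submatrix id
              (Subtype.val : {i : Fin n // i ∉ unerased z} → Fin n)).rank < k
          · simpa only [g, if_pos h, mul_one] using log_ratio_le M hε0 hε1 s z hpos
          · rw [jointSZbec_eq_mul M ε s z h, div_self hpos.ne']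
            simp [g, h]
    _ = ∑ x, n * ∑ z, becJoint n ε x z * g (unerased z) := by
        rw [Finset.sum_comm]
        simp only [← Finset.sum_mul, sum_jointSZbec_left]
        simp only [Finset.sum_mul, Finset.mul_sum]
        rw [Finset.sum_comm]
        exact Finset.sum_congr rfl fun x _ => Finset.sum_congr rfl fun z _ => by ring
    _ = n * pmlBEC k n M (1 - ε) := by
        simp only [sum_becJoint_mul]
        simp [pmlBEC, g]
        field_simp
end

section
/- Let 0 < ε < 1 and R ∈ ℝ. The function p ↦ −p log(1−ε) + (log 2 − R) − h(p) is convex on [0,1], and the constrained minimum min{ −p log(1−ε) + (log 2 − R) − h(p) : p ∈ [0,1], h(p) ≥ log 2 − R } equals the Lagrangian dual value sup_{λ ≥ 0} L(λ), where L(λ) := min_{p ∈ [0,1]} [ −p log(1−ε) + (1+λ)·( log 2 − R − h(p) ) ] and h(p) = −p log p − (1−p) log(1−p), provided 0 ≤ R ≤ log 2. -/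
open scoped BigOperators

/-- Binary entropy function `h(p) = -p log p - (1-p) log (1-p)` (natural logarithm,
with `0 log 0 = 0`). -/
noncomputable def binEnt (p : ℝ) : ℝ :=
  Real.negMulLog p + Real.negMulLog (1 - p)

/-- The Lagrangian value
`L(λ) = min_{p ∈ [0,1]} [ -p log(1-ε) + (1+λ)(log 2 - R - h(p)) ]`. -/
noncomputable def Lag (ε R lam : ℝ) : ℝ :=
  sInf {y : ℝ | ∃ p : ℝ, 0 ≤ p ∧ p ≤ 1 ∧
    y = -p * Real.log (1 - ε) + (1 + lam) * (Real.log 2 - R - binEnt p)}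

theorem binEnt_eq_binEntropy (p : ℝ) : binEnt p = Real.binEntropy p :=
  (Real.binEntropy_eq_negMulLog_add_negMulLog_one_sub p).symm

theorem negMulLog_le_tangent {p q : ℝ} (hp : 0 ≤ p) (hq : 0 < q) :
    Real.negMulLog p ≤ -p * Real.log q + (q - p) := by
  rcases hp.eq_or_lt with rfl | hp
  · simpa using hq.le
  · have h := Real.log_le_sub_one_of_pos (div_pos hq hp)
    rw [Real.log_div hq.ne' hp.ne'] at h
    have h' := mul_le_mul_of_nonneg_left h hp.le
    have e : p * (q / p - 1) = q - p := by field_simp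
    rw [e] at h'
    unfold Real.negMulLog
    linarith

/-- The graph of the binary entropy lies below its tangent lines. -/
theorem binEnt_le_tangent {p q : ℝ} (hp0 : 0 ≤ p) (hp1 : p ≤ 1) (hq0 : 0 < q) (hq1 : q < 1) :
    binEnt p ≤ binEnt q + (Real.log (1 - q) - Real.log q) * (p - q) := by
  have h1 := negMulLog_le_tangent hp0 hq0
  have h2 := negMulLog_le_tangent (sub_nonneg.2 hp1) (sub_pos.2 hq1)
  have h3 : binEnt q = -q * Real.log q + -(1 - q) * Real.log (1 - q) := rfl
  have h4 : binEnt p = Real.negMulLog p + Real.negMulLog (1 - p) := rfl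
  rw [h3, h4]
  linarith

theorem binEnt_le_log_two (p : ℝ) : binEnt p ≤ Real.log 2 := by
  rw [binEnt_eq_binEntropy]
  exact Real.binEntropy_le_log_two

theorem convexOn_objective (ε R : ℝ) :
    ConvexOn ℝ (Set.Icc (0:ℝ) 1)
      (fun p => -p * Real.log (1 - ε) + (Real.log 2 - R) - binEnt p) := by
  have h := Real.strictConcave_binEntropy.concaveOn.neg
  refine ⟨convex_Icc 0 1, fun x hx y hy s t hs ht hst => ?_⟩
  have h1 := h.2 hx hy hs ht hst
  simp only [Pi.neg_apply, smul_eq_mul, binEnt_eq_binEntropy] at h1 ⊢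
  linear_combination h1 - (Real.log 2 - R) * hst

theorem lag_le {ε R lam p : ℝ} (hε0 : 0 < ε) (hε1 : ε < 1) (hlam : 0 ≤ lam)
    (hp0 : 0 ≤ p) (hp1 : p ≤ 1) :
    Lag ε R lam ≤ -p * Real.log (1 - ε) + (1 + lam) * (Real.log 2 - R - binEnt p) := by
  refine csInf_le ⟨(1 + lam) * (-R), ?_⟩ ⟨p, hp0, hp1, rfl⟩
  rintro y ⟨x, hx0, -, rfl⟩
  have ha : Real.log (1 - ε) < 0 := Real.log_neg (by linarith) (by linarith)
  nlinarith [mul_nonneg (by linarith : 0 ≤ 1 + lam) (sub_nonneg.2 (binEnt_le_log_two x)),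
    mul_nonneg hx0 (neg_nonneg.2 ha.le)]

/-- If the multiplier makes `q` a critical point of the Lagrangian, then `q` is a minimizer. -/
theorem le_lag_of_critical {ε R lam q : ℝ} (hlam : 0 ≤ lam) (hq0 : 0 < q) (hq1 : q < 1)
    (hcrit : (1 + lam) * (Real.log (1 - q) - Real.log q) = -Real.log (1 - ε)) :
    -q * Real.log (1 - ε) + (1 + lam) * (Real.log 2 - R - binEnt q) ≤ Lag ε R lam := by
  refine le_csInf ⟨_, 0, le_rfl, zero_le_one, rfl⟩ ?_
  rintro y ⟨p, hp0, hp1, rfl⟩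
  have h := mul_le_mul_of_nonneg_left (binEnt_le_tangent hp0 hp1 hq0 hq1)
    (by linarith : 0 ≤ 1 + lam)
  linear_combination h + (p - q) * hcrit

/-- the objective `p ↦ -p log(1-ε) + (log 2 - R) - h(p)` is convex on
`[0,1]`, and (provided `0 ≤ R ≤ log 2`) the constrained minimum over
`{p ∈ [0,1] : h(p) ≥ log 2 - R}` equals the Lagrangian dual value `sup_{λ ≥ 0} L(λ)`. -/
theorem convexity_and_strong_duality (ε R : ℝ) (hε0 : 0 < ε) (hε1 : ε < 1) :
    ConvexOn ℝ (Set.Icc (0:ℝ) 1)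
      (fun p => -p * Real.log (1 - ε) + (Real.log 2 - R) - binEnt p) ∧
    (0 ≤ R → R ≤ Real.log 2 →
      sInf {y : ℝ | ∃ p : ℝ, 0 ≤ p ∧ p ≤ 1 ∧ Real.log 2 - R ≤ binEnt p ∧
          y = -p * Real.log (1 - ε) + (Real.log 2 - R) - binEnt p} =
        sSup {y : ℝ | ∃ lam : ℝ, 0 ≤ lam ∧ y = Lag ε R lam}) := by
  refine ⟨convexOn_objective ε R, fun hR0 hR1 => ?_⟩
  have ha : Real.log (1 - ε) < 0 := Real.log_neg (by linarith) (by linarith)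
  have hhalf : binEnt 2⁻¹ = Real.log 2 := by
    rw [binEnt_eq_binEntropy, Real.binEntropy_two_inv]
  set P := {y : ℝ | ∃ p : ℝ, 0 ≤ p ∧ p ≤ 1 ∧ Real.log 2 - R ≤ binEnt p ∧
    y = -p * Real.log (1 - ε) + (Real.log 2 - R) - binEnt p}
  set D := {y : ℝ | ∃ lam : ℝ, 0 ≤ lam ∧ y = Lag ε R lam}
  have hPne : P.Nonempty :=
    ⟨_, 2⁻¹, by norm_num, by norm_num, by rw [hhalf]; linarith, rfl⟩
  have hPbdd : BddBelow P := by
    refine ⟨-R, ?_⟩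
    rintro y ⟨p, hp0, -, -, rfl⟩
    nlinarith [binEnt_le_log_two p, mul_nonneg hp0 (neg_nonneg.2 ha.le)]
  have hweak : ∀ y ∈ D, y ≤ sInf P := by
    rintro y ⟨lam, hlam, rfl⟩
    refine le_csInf hPne ?_
    rintro y ⟨p, hp0, hp1, hp, rfl⟩
    have := lag_le (R := R) hε0 hε1 hlam hp0 hp1
    nlinarith [mul_nonneg hlam (sub_nonneg.2 hp)]
  have hDbdd : BddAbove D := ⟨_, hweak⟩
  refine le_antisymm ?_ (csSup_le ⟨_, 0, le_rfl, rfl⟩ hweak)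
  -- The unconstrained minimizer of the objective.
  obtain ⟨r, hr⟩ : ∃ r, r = (1 - ε) / (2 - ε) := ⟨_, rfl⟩
  have hr0 : 0 < r := hr ▸ div_pos (by linarith) (by linarith)
  have hr2 : r < 2⁻¹ := by
    rw [hr, div_lt_iff₀ (by linarith)]
    linarith
  have hrcrit : Real.log (1 - r) - Real.log r = -Real.log (1 - ε) := by
    have h1 : 1 - r = 1 / (2 - ε) := by
      rw [hr]
      field_simp [(by linarith : 2 - ε ≠ 0)]
      ring
    rw [h1, hr, Real.log_div (by linarith) (by linarith), Real.log_div (by linarith) (by linarith),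
      Real.log_one]
    ring
  by_cases hc : Real.log 2 - R ≤ binEnt r
  · have h1 : sInf P ≤ _ := csInf_le hPbdd ⟨r, hr0.le, by linarith, hc, rfl⟩
    have h2 := le_lag_of_critical (ε := ε) (R := R) le_rfl hr0 (by linarith)
      (by rw [add_zero, one_mul, hrcrit])
    have h3 : Lag ε R 0 ≤ sSup D := le_csSup hDbdd ⟨0, le_rfl, rfl⟩
    linarith
  · push Not at hc
    obtain ⟨s, ⟨hrs, hs2⟩, hs⟩ : Real.log 2 - R ∈ Real.binEntropy '' Set.Icc r 2⁻¹ := by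
      refine intermediate_value_Icc hr2.le Real.binEntropy_continuous.continuousOn ⟨?_, ?_⟩
      · rw [← binEnt_eq_binEntropy]; exact hc.le
      · rw [Real.binEntropy_two_inv]; linarith
    have hrs' : r < s := by
      refine hrs.lt_of_ne ?_
      rintro rfl
      rw [binEnt_eq_binEntropy] at hc
      linarith
    have h1 : sInf P ≤ -s * Real.log (1 - ε) + (Real.log 2 - R) - binEnt s :=
      csInf_le hPbdd ⟨s, by linarith, by linarith, by rw [binEnt_eq_binEntropy, hs], rfl⟩
    rw [binEnt_eq_binEntropy, hs] at h1
    -- The dual value at the multiplier attached to `q` tends to the optimum as `q` increases to `s`.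
    have key : ∀ q, r < q → q < s → q * -Real.log (1 - ε) ≤ sSup D := by
      intro q hrq hqs
      have hq0 : 0 < q := hr0.trans hrq
      have hd0 : 0 < Real.log (1 - q) - Real.log q :=
        sub_pos.2 (Real.log_lt_log hq0 (by linarith))
      have hda : Real.log (1 - q) - Real.log q ≤ -Real.log (1 - ε) := by
        rw [← hrcrit]
        exact sub_le_sub (Real.log_le_log (by linarith) (by linarith))
          (Real.log_le_log hr0 hrq.le)
      obtain ⟨lam, hl⟩ : ∃ lam, lam = -Real.log (1 - ε) / (Real.log (1 - q) - Real.log q) - 1 :=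
        ⟨_, rfl⟩
      have hlam : 0 ≤ lam := by
        rw [hl, sub_nonneg, le_div_iff₀ hd0, one_mul]
        exact hda
      have h2 := le_lag_of_critical (ε := ε) (R := R) hlam hq0 (by linarith)
        (by rw [hl, add_sub_cancel, div_mul_cancel₀ _ hd0.ne'])
      have h3 : Lag ε R lam ≤ sSup D := le_csSup hDbdd ⟨lam, hlam, rfl⟩
      have h4 : binEnt q ≤ Real.log 2 - R := by
        rw [binEnt_eq_binEntropy, ← hs]
        exact Real.binEntropy_strictMonoOn.monotoneOn ⟨hq0.le, by linarith⟩
          ⟨by linarith, hs2⟩ hqs.le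
      nlinarith [mul_nonneg (by linarith : 0 ≤ 1 + lam) (sub_nonneg.2 h4)]
    by_contra! hlt
    have h5 : sSup D / -Real.log (1 - ε) < s := by
      rw [div_lt_iff₀ (by linarith)]
      linarith
    obtain ⟨q, hq, hqs⟩ := exists_between (max_lt hrs' h5)
    have h6 := key q ((le_max_left _ _).trans_lt hq) hqs
    have h7 := (le_max_right _ _).trans_lt hq
    rw [div_lt_iff₀ (by linarith)] at h7
    linarith
end
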